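/- Let V be a faithful irreducible four-dimensional complex representation of the quasi-simple group SL2(F7). Then there are no nonzero SL2(F7)-invariant homogeneous polynomial functions on V of degree 1, 2, or 3, and the space of invariant homogeneous polynomials of degree 4 is one-dimensional. -/

import Mathlib

/-- The quasi-simple group `SL₂(F₇)`. -/
abbrev SL2F7 : Type := Matrix.SpecialLinearGroup (Fin 2) (ZMod 7)

/-- The space of homogeneous polynomial functions of degree `d` on `V`: the span, inside the
space of all functions `V → ℂ`, of products of `d` linear functionals. -/
noncomputable def homPoly (V : Type*) [AddCommGroup V] [Module ℂ V] (d : ℕ) :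
    Submodule ℂ (V → ℂ) :=
  Submodule.span ℂ {f | ∃ φ : Fin d → Module.Dual ℂ V, f = fun v => ∏ i, φ i v}


theorem quartic_S (p x0 x1 x2 x3 y0 y1 y2 y3 : ℂ) (hp : p^3+p^2-2*p-1=0)
  (h0 : y0 = x0+2*x1+2*x2+2*x3) (h1 : y1 = x0 + (p^2-2)*x1 + p*x2 + (1-p-p^2)*x3)
  (h2 : y2 = x0 + p*x1 + (1-p-p^2)*x2 + (p^2-2)*x3)
  (h3 : y3 = x0 + (1-p-p^2)*x1 + (p^2-2)*x2 + p*x3) :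
  y0^4 + 24*(y0*y1*y2*y3) + 8*(y1^3*y3+y2^3*y1+y3^3*y2) =
   49*(x0^4 + 24*(x0*x1*x2*x3) + 8*(x1^3*x3+x2^3*x1+x3^3*x2)) := by
  subst h0 h1 h2 h3
  linear_combination ((-8)*x1^4*p^5 + (16)*x1^3*x2^1*p^5 + (16)*x1^3*x3^1*p^5 + (-24)*x1^2*x3^2*p^5 + (16)*x1^1*x3^3*p^5 + (16)*x2^1*x3^3*p^5 + (16)*x1^1*x2^3*p^5 + (16)*x2^3*x3^1*p^5 + (-24)*x2^2*x3^2*p^5 + (-8)*x3^4*p^5 + (-24)*x1^2*x2^2*p^5 + (-8)*x2^4*p^5 + (-8)*x1^4*p^4 + (16)*x1^3*x3^1*p^4 + (16)*x1^3*x2^1*p^4 + (-24)*x1^2*x2^2*p^4 + (-24)*x1^2*x3^2*p^4 + (16)*x1^1*x3^3*p^4 + (-24)*x2^2*x3^2*p^4 + (16)*x2^1*x3^3*p^4 + (-8)*x3^4*p^4 + (16)*x1^1*x2^3*p^4 + (16)*x2^3*x3^1*p^4 + (-8)*x2^4*p^4 + (48)*x0^1*x1^2*x2^1*p^3 + (48)*x0^1*x2^2*x3^1*p^3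 + (48)*x0^1*x1^1*x3^2*p^3 + (-88)*x1^3*x3^1*p^3 + (-88)*x1^1*x2^3*p^3 + (-88)*x2^1*x3^3*p^3 + (-24)*x0^1*x1^3*p^3 + (-144)*x0^1*x1^1*x2^1*x3^1*p^3 + (24)*x1^4*p^3 + (24)*x1^2*x2^1*x3^1*p^3 + (24)*x1^1*x2^2*x3^1*p^3 + (24)*x1^1*x2^1*x3^2*p^3 + (24)*x3^4*p^3 + (-24)*x0^1*x3^3*p^3 + (24)*x0^1*x2^1*x3^2*p^3 + (24)*x2^4*p^3 + (-24)*x0^1*x2^3*p^3 + (24)*x0^1*x1^2*x3^1*p^3 + (24)*x0^1*x1^1*x2^2*p^3 + (16)*x1^3*x2^1*p^3 + (16)*x1^1*x3^3*p^3 + (16)*x2^3*x3^1*p^3 + (24)*x1^2*x2^2*p^3 + (24)*x1^2*x3^2*p^3 + (24)*x2^2*x3^2*p^3 + (-24)*x0^1*x1^3*p^2 + (-144)*x0^1*x1^1*x2^1*x3^1*p^2 + (-24)*x0^1*x2^3*p^2 + (-120)*x0^1*x2^2*x3^1*p^2 + (-24)*x0^1*x3^3*p^2 + (88)*x1^3*x2^1*p^2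 + (168)*x1^2*x2^2*p^2 + (-144)*x1^2*x2^1*x3^1*p^2 + (-72)*x1^3*x3^1*p^2 + (168)*x1^2*x3^2*p^2 + (-72)*x1^1*x2^3*p^2 + (-144)*x1^1*x2^2*x3^1*p^2 + (-144)*x1^1*x2^1*x3^2*p^2 + (88)*x2^3*x3^1*p^2 + (168)*x2^2*x3^2*p^2 + (-72)*x2^1*x3^3*p^2 + (88)*x1^1*x3^3*p^2 + (192)*x0^1*x1^2*x3^1*p^2 + (192)*x0^1*x1^1*x2^2*p^2 + (192)*x0^1*x2^1*x3^2*p^2 + (-120)*x0^1*x1^1*x3^2*p^2 + (-120)*x0^1*x1^2*x2^1*p^2 + (-40)*x1^4*p^2 + (-40)*x3^4*p^2 + (-40)*x2^4*p^2 + (-48)*x0^1*x1^2*x3^1*p^1 + (-264)*x0^1*x1^2*x2^1*p^1 + (-48)*x0^1*x1^1*x2^2*p^1 + (792)*x0^1*x1^1*x2^1*x3^1*p^1 + (-264)*x0^1*x2^2*x3^1*p^1 + (-48)*x0^1*x2^1*x3^2*p^1 + (-264)*x0^1*x1^1*x3^2*p^1 + (48)*x0^1*x3^3*p^1 + (-72)*x1^4*p^1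 + (336)*x1^3*x3^1*p^1 + (-96)*x1^3*x2^1*p^1 + (48)*x1^2*x2^2*p^1 + (-216)*x1^2*x2^1*x3^1*p^1 + (336)*x1^1*x2^3*p^1 + (-216)*x1^1*x2^2*x3^1*p^1 + (-216)*x1^1*x2^1*x3^2*p^1 + (48)*x1^2*x3^2*p^1 + (-96)*x1^1*x3^3*p^1 + (-72)*x2^4*p^1 + (-96)*x2^3*x3^1*p^1 + (48)*x2^2*x3^2*p^1 + (336)*x2^1*x3^3*p^1 + (-72)*x3^4*p^1 + (48)*x0^1*x1^3*p^1 + (48)*x0^1*x2^3*p^1 + (24)*x0^1*x1^3 + (120)*x0^1*x1^2*x2^1 + (144)*x0^1*x1^1*x2^1*x3^1 + (-192)*x0^1*x1^1*x2^2 + (-192)*x0^1*x1^2*x3^1 + (120)*x0^1*x1^1*x3^2 + (24)*x0^1*x2^3 + (-192)*x0^1*x2^1*x3^2 + (24)*x0^1*x3^3 + (48)*x1^4 + (-104)*x1^3*x2^1 + (144)*x1^2*x2^1*x3^1 + (-144)*x1^2*x2^2 + (56)*x1^3*x3^1 + (-144)*x1^2*x3^2 + (56)*x1^1*x2^3 +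 (144)*x1^1*x2^2*x3^1 + (144)*x1^1*x2^1*x3^2 + (-104)*x1^1*x3^3 + (48)*x2^4 + (-104)*x2^3*x3^1 + (-144)*x2^2*x3^2 + (56)*x2^1*x3^3 + (48)*x3^4 + (120)*x0^1*x2^2*x3^1) * hp
def gT : SL2F7 := ⟨!![1,1;0,1], by decide⟩
def gS : SL2F7 := ⟨!![0,-1;1,0], by decide⟩
def gD : SL2F7 := ⟨!![2,0;0,4], by decide⟩

theorem rel_T7 : gT^7 = 1 := by decide +kernel
theorem rel_T1 : gT ≠ 1 := by decide +kernel
theorem rel_neg : (-1 : SL2F7) ≠ 1 := by decide +kernel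
theorem rel_D3 : gD^3 = 1 := by decide +kernel
theorem rel_TD : gT * gD = gD * gT^2 := by decide +kernel
theorem rel_SD : gS * gD = gD * gD * gS := by decide +kernel
theorem rel_DD : gD * gD = gS * gD * gS^3 := by decide +kernel
theorem rel_S4 : gS^3 * gS * gD = gD := by decide +kernel
theorem rel_SS : gS * gS = -1 := by decide +kernel
theorem rel_ST : gT * gS * gT * gS * gT = gS := by decide +kernel

theorem gT_pow (x : ZMod 7) : ((gT ^ x.val : SL2F7) : Matrix (Fin 2) (Fin 2) (ZMod 7)) = !![1,x;0,1] := by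
  revert x; decide +kernel

theorem gS_cube : ((gS^3 : SL2F7) : Matrix (Fin 2) (Fin 2) (ZMod 7)) = !![0,1;-1,0] := by
  decide +kernel

theorem gen_aux (g : SL2F7) (h : g.1 1 0 ≠ 0) :
    ∃ i j k : ℕ, g = gT^i * (gS * gT^j * gS^3) * gT^k := by
  have : Fact (Nat.Prime 7) := ⟨by norm_num⟩
  refine ⟨((g.1 0 0 - 1)/g.1 1 0).val, (-g.1 1 0).val, ((g.1 1 1 - 1)/g.1 1 0).val, ?_⟩
  have hdet := g.2
  rw [Matrix.det_fin_two] at hdet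
  have hS1 : (gS : Matrix (Fin 2) (Fin 2) (ZMod 7)) = !![0,-1;1,0] := rfl
  apply Subtype.ext
  simp only [Matrix.SpecialLinearGroup.coe_mul, gT_pow, gS_cube, hS1]
  ext i j
  fin_cases i <;> fin_cases j <;> simp [Matrix.mul_apply, Fin.sum_univ_two] 
  · field_simp; ring
  · field_simp; linear_combination -hdet
  · field_simp; ring

theorem gen_ind (C : SL2F7 → Prop) (hmul : ∀ g h, C g → C h → C (g*h)) (h1 : C 1)
    (hT : C gT) (hS : C gS) (g : SL2F7) : C g := by
  have hpow : ∀ g, C g → ∀ n : ℕ, C (g^n) := by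
    intro g hg n
    induction n with
    | zero => simpa using h1
    | succ n ih => rw [pow_succ]; exact hmul _ _ ih hg
  have key : ∀ g : SL2F7, g.1 1 0 ≠ 0 → C g := by
    intro g hg
    obtain ⟨i, j, k, rfl⟩ := gen_aux g hg
    exact hmul _ _ (hmul _ _ (hpow _ hT _) (hmul _ _ (hmul _ _ hS (hpow _ hT _)) (hpow _ hS _))) (hpow _ hT _)
  by_cases h : g.1 1 0 = 0
  · have e : g = gS^3 * (gS * g) := by
      rw [← mul_assoc, ← pow_succ, show gS^(3+1) = 1 by decide +kernel, one_mul]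
    rw [e]
    refine hmul _ _ (hpow _ hS _) (key _ ?_)
    have hdet := g.2
    rw [Matrix.det_fin_two, h] at hdet
    intro h0
    have hS1 : (gS : Matrix (Fin 2) (Fin 2) (ZMod 7)) = !![0,-1;1,0] := rfl
    change ((gS * g : SL2F7) : Matrix (Fin 2) (Fin 2) (ZMod 7)) 1 0 = 0 at h0
    rw [Matrix.SpecialLinearGroup.coe_mul, hS1] at h0
    simp [Matrix.mul_apply, Fin.sum_univ_two] at h0
    rw [h0] at hdet
    simp at hdet
    exact absurd hdet (by decide)
  · exact key g h

theorem circ0 (z x y w : ℂ) (z7 : z^7=1) (hd : z^3+z^6+z^5-3 ≠ 0)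
  (h1 : z*x+z^2*y+z^4*w=0) (h2 : z*y+z^2*w+z^4*x=0) (h3 : z*w+z^2*x+z^4*y=0) : x = 0 := by
  have : (z^3+z^6+z^5-3)*x = 0 := by
    linear_combination (z^2-z^6)*h1+(z^8-z^3)*h2+(z^4-z^5)*h3 - (z^5-3)*x*z7
  simpa [hd] using this

theorem solveS (z a b c P Q R : ℂ) (hz : z^6+z^5+z^4+z^3+z^2+z+1=0)
  (h1 : a^2+3*(b*c) = -1) (h2 : a^2+b*c*(z+z^2+z^4)=a) (h3 : b*(a+P+Q+R)=0)
  (h4 : z*(a*b+b*(z*P+z^2*Q+z^4*R)) = b)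
  (h5 : z^2*(a*b+b*(z*Q+z^2*R+z^4*P)) = b)
  (h6 : z^4*(a*b+b*(z*R+z^2*P+z^4*Q)) = b) :
  a^2 = -1/7 ∧ b*c = 2*a^2 ∧ P = a*((z+z^6)^2-2) ∧ Q = a*(z+z^6) ∧ R = a*(1-(z+z^6)-(z+z^6)^2) := by
  have z7 : z^7 = 1 := by linear_combination (z-1)*hz
  have hb : b ≠ 0 := by
    rintro rfl
    have : a = -1 := by linear_combination h1 - h2
    rw [this] at h1; norm_num at h1
  have h3 : a+P+Q+R=0 := by simpa [hb] using h3
  have h4 : a+(z*P+z^2*Q+z^4*R) = z^6 := by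
    apply mul_left_cancel₀ hb; linear_combination z^6*h4 - b*(a+(z*P+z^2*Q+z^4*R))*z7
  have h5 : a+(z*Q+z^2*R+z^4*P) = z^5 := by
    apply mul_left_cancel₀ hb; linear_combination z^5*h5 - b*(a+(z*Q+z^2*R+z^4*P))*z7
  have h6 : a+(z*R+z^2*P+z^4*Q) = z^3 := by
    apply mul_left_cancel₀ hb; linear_combination z^3*h6 - b*(a+(z*R+z^2*P+z^4*Q))*z7
  obtain ⟨w, hw⟩ : ∃ w, w = z^3+z^5+z^6 := ⟨_, rfl⟩
  have hu : z+z^2+z^4 = -1-w := by rw [hw]; linear_combination hz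
  have hw2 : w^2+w+2=0 := by
    rw [hw]; linear_combination 2*hz + (z^5+2*z^4+z^3+2*z^2+2*z)*z7 - 0*z7
  have e : a*(3-(z+z^2+z^4)) = w := by
      rw [hw]; linear_combination h4+h5+h6 - (z+z^2+z^4)*h3
  rw [hu] at e h2
  have ha : 7*a = 1 + 2*w := by linear_combination (1/2)*(3-w)*e+(a/2-1/2)*hw2
  have ha2 : a^2 = -1/7 := by
    linear_combination (1/49)*(7*a+1+2*w)*ha+(4/49)*hw2
  have hd : z^3+z^6+z^5-3 ≠ 0 := by
    intro h
    have : w = 3 := by rw [hw]; linear_combination h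
    rw [this] at hw2; norm_num at hw2
  have hbc : b*c = 2*a^2 := by linear_combination (1/3)*h1 - (7/3)*ha2
  rw [hw] at ha
  have e1 : P - a*(z^2+z^5) + (Q - a*(z+z^6)) + (R-a*(z^3+z^4))=0 := by
    linear_combination h3 - a*hz
  have k1 : z*(P - a*(z^2+z^5)) + z^2*(Q - a*(z+z^6)) + z^4*(R-a*(z^3+z^4))=0 := by
    linear_combination h4 - (1/7)*(1+(z*(z^2+z^5)+z^2*(z+z^6)+z^4*(z^3+z^4)))*ha + (1/7)*((-4)*z^8 + (-2)*z^7 + (2)*z^6 + (-2)*z^5 + (4)*z^4 + (-4)*z^3 + (1)*z^1 + (-1)*z^0)*hz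
  have k2 : z*(Q - a*(z+z^6)) + z^2*(R-a*(z^3+z^4)) + z^4*(P - a*(z^2+z^5))=0 := by
    linear_combination h5 - (1/7)*(1+(z*(z+z^6)+z^2*(z^3+z^4)+z^4*(z^2+z^5)))*ha + (1/7)*((-2)*z^9 + (-6)*z^6 + (2)*z^5 + (2)*z^4 + (-1)*z^3 + (-1)*z^2 + (1)*z^1 + (-1)*z^0)*hz
  have k3 : z*(R-a*(z^3+z^4)) + z^2*(P - a*(z^2+z^5)) + z^4*(Q - a*(z+z^6))=0 := by
    linear_combination h6 - (1/7)*(1+(z*(z^3+z^4)+z^2*(z^2+z^5)+z^4*(z+z^6)))*ha + (1/7)*((-2)*z^10 + (2)*z^8 + (-4)*z^7 + (2)*z^6 + (-2)*z^5 + (-7)*z^4 + (5)*z^3 + (1)*z^1 + (-1)*z^0)*hz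
  have r1 := circ0 _ _ _ _ z7 hd k1 k2 k3
  have r2 := circ0 _ _ _ _ z7 hd k2 k3 k1
  have r3 := circ0 _ _ _ _ z7 hd k3 k1 k2
  have q1 : (z+z^6)^2-2 = z^2+z^5 := by linear_combination (2+z^5)*z7
  refine ⟨ha2, hbc, ?_, ?_, ?_⟩
  · rw [q1]; linear_combination r1
  · linear_combination r2
  · rw [show 1-(z+z^6)-(z+z^6)^2 = z^3+z^4 by linear_combination -q1-hz]; linear_combination r3
theorem homPoly_le {V : Type} [AddCommGroup V] [Module ℂ V] (L : V ≃ₗ[ℂ] (Fin 4 → ℂ)) (d : ℕ) :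
    homPoly V d ≤ Submodule.span ℂ (Set.range fun (m : Fin d → Fin 4) (v : V) => ∏ i, L v (m i)) := by
  unfold homPoly
  rw [Submodule.span_le]
  rintro f ⟨φ, rfl⟩
  have e : ∀ (ψ : Module.Dual ℂ V) v, ψ v = ∑ j, ψ (L.symm (Pi.single j 1)) * L v j := by
    intro ψ v
    have : v = ∑ j, L v j • L.symm (Pi.single j 1) := by
      apply L.injective
      simp only [map_sum, map_smul, LinearEquiv.apply_symm_apply]
      exact pi_eq_sum_univ' (L v)
    conv_lhs => rw [this]
    simp [mul_comm]
  have : (fun v => ∏ i, φ i v) = ∑ m : Fin d → Fin 4, (∏ i, φ i (L.symm (Pi.single (m i) 1))) •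
      (fun v : V => ∏ i, L v (m i)) := by
    funext v
    simp only [Finset.sum_apply, Pi.smul_apply, smul_eq_mul]
    simp_rw [← Finset.prod_mul_distrib]
    rw [← Fintype.piFinset_univ, ← Finset.prod_univ_sum (fun _ => Finset.univ)
      (fun i j => φ i (L.symm (Pi.single j 1)) * L v j)]
    exact Finset.prod_congr rfl fun i _ => e _ _
  rw [this]
  exact Submodule.sum_mem _ fun m _ => Submodule.smul_mem _ _ (Submodule.subset_span ⟨m, rfl⟩)

theorem homPoly_neg {V : Type} [AddCommGroup V] [Module ℂ V] (d : ℕ) (f : V → ℂ)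
    (hf : f ∈ homPoly V d) : ∀ v, f (-v) = (-1)^d * f v := by
  unfold homPoly at hf
  induction hf using Submodule.span_induction with
  | mem x h =>
    obtain ⟨φ, rfl⟩ := h
    intro v
    simp only [map_neg]
    rw [Finset.prod_neg]; simp
  | zero => simp
  | add x y _ _ hx hy => intro v; simp [hx, hy, mul_add]
  | smul a x _ hx => intro v; simp [hx]; ring

theorem z_order (z : ℂ) (hz : z^6+z^5+z^4+z^3+z^2+z+1=0) : orderOf z = 7 := by
  have : Fact (Nat.Prime 7) := ⟨by norm_num⟩
  have z7 : z^7 = 1 := by linear_combination (z-1)*hz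
  refine orderOf_eq_prime z7 ?_
  rintro rfl
  norm_num at hz

def wt : Fin 4 → ℕ := ![0,1,2,4]

theorem avg_mem {V : Type} [AddCommGroup V] [Module ℂ V] (L : V ≃ₗ[ℂ] (Fin 4 → ℂ)) (d : ℕ)
    (z : ℂ) (hz : z^6+z^5+z^4+z^3+z^2+z+1=0) (τ : V → V)
    (hτ : ∀ v i, L (τ v) i = z^(wt i) * L v i) (f : V → ℂ) (hf0 : f ∈ homPoly V d)
    (hinv : ∀ v, f (τ v) = f v) :
    f ∈ Submodule.span ℂ {h : V → ℂ | ∃ m : Fin d → Fin 4, 7 ∣ ∑ i, wt (m i) ∧ h = fun v => ∏ i, L v (m i)} := by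
  have hf := homPoly_le L d hf0
  have z7 : z^7 = 1 := by linear_combination (z-1)*hz
  have hit : ∀ n v i, L (τ^[n] v) i = (z^(wt i))^n * L v i := by
    intro n
    induction n with
    | zero => simp
    | succ n ih => intro v i; rw [Function.iterate_succ_apply', hτ, ih]; ring
  have key : (fun v => ∑ n ∈ Finset.range 7, f (τ^[n] v)) ∈ Submodule.span ℂ {h : V → ℂ | ∃ m : Fin d → Fin 4, 7 ∣ ∑ i, wt (m i) ∧ h = fun v => ∏ i, L v (m i)} := by
    clear hinv hf0
    induction hf using Submodule.span_induction with
    | mem x h =>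
      obtain ⟨m, rfl⟩ := h
      have e : (fun v => ∑ n ∈ Finset.range 7, ∏ i, L (τ^[n] v) (m i)) =
          (∑ n ∈ Finset.range 7, (z^(∑ i, wt (m i)))^n) • fun v => ∏ i, L v (m i) := by
        funext v
        simp only [hit, Finset.prod_mul_distrib, Pi.smul_apply, smul_eq_mul, Finset.sum_mul,
          Finset.prod_pow, Finset.prod_pow_eq_pow_sum]
      simp only [e]
      by_cases h7 : 7 ∣ ∑ i, wt (m i)
      · exact Submodule.smul_mem _ _ (Submodule.subset_span ⟨m, h7, rfl⟩)
      · have : ∑ n ∈ Finset.range 7, (z^(∑ i, wt (m i)))^n = 0 := by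
          generalize ∑ i, wt (m i) = w at h7
          have hu : z^w ≠ 1 := fun h => h7 ((z_order z hz) ▸ orderOf_dvd_of_pow_eq_one h)
          have h0 : (z^w - 1) * ∑ n ∈ Finset.range 7, (z^w)^n = 0 := by
            rw [mul_geom_sum, ← pow_mul, mul_comm, pow_mul, z7, one_pow, sub_self]
          exact (mul_eq_zero.1 h0).resolve_left (sub_ne_zero.2 hu)
        rw [this, zero_smul]
        exact Submodule.zero_mem _
    | zero =>
      convert Submodule.zero_mem _ using 1
      funext v; simp
    | add x y _ _ hx hy =>
      convert Submodule.add_mem _ hx hy using 1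
      funext v; simp [Finset.sum_add_distrib]
    | smul a x _ hx =>
      convert Submodule.smul_mem _ a hx using 1
      funext v; simp [Finset.mul_sum]
  have hi : ∀ n v, f (τ^[n] v) = f v := by
    intro n
    induction n with
    | zero => simp
    | succ n ih => intro v; rw [Function.iterate_succ_apply', hinv, ih]
  have : f = (1/7 : ℂ) • (fun v => ∑ n ∈ Finset.range 7, f (τ^[n] v)) := by
    funext v; simp [hi]
  rw [this]
  exact Submodule.smul_mem _ _ key

theorem mons4 : ∀ m : Fin 4 → Fin 4, 7 ∣ ∑ i, wt (m i) →
    (Finset.univ.val.map m = {0,0,0,0} ∨ Finset.univ.val.map m = {0,1,2,3} ∨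
     Finset.univ.val.map m = {1,1,1,3} ∨ Finset.univ.val.map m = {2,2,2,1} ∨
     Finset.univ.val.map m = {3,3,3,2}) := by decide +kernel

theorem mons2 : ∀ m : Fin 2 → Fin 4, 7 ∣ ∑ i, wt (m i) →
    Finset.univ.val.map m = {0,0} := by decide +kernel

theorem prod_ms {d : ℕ} (m : Fin d → Fin 4) (x : Fin 4 → ℂ) :
    ∏ i, x (m i) = ((Finset.univ.val.map m).map x).prod := by
  rw [Multiset.map_map]; rfl

theorem form4 {V : Type} (L : V → (Fin 4 → ℂ)) (f : V → ℂ)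
    (hf : f ∈ Submodule.span ℂ {h : V → ℂ | ∃ m : Fin 4 → Fin 4, 7 ∣ ∑ i, wt (m i) ∧ h = fun v => ∏ i, L v (m i)}) :
    ∃ A B C1 C2 C3 : ℂ, ∀ v, f v = A * (L v 0)^4 + B*(L v 0 * L v 1 * L v 2 * L v 3) +
      C1*((L v 1)^3*L v 3) + C2*((L v 2)^3*L v 1) + C3*((L v 3)^3*L v 2) := by
  induction hf using Submodule.span_induction with
  | mem x h =>
    obtain ⟨m, hm, rfl⟩ := h
    rcases mons4 m hm with h | h | h | h | h
    · refine ⟨1,0,0,0,0, fun v => ?_⟩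
      simp only [prod_ms, h]; simp; ring
    · refine ⟨0,1,0,0,0, fun v => ?_⟩
      simp only [prod_ms, h]; simp; ring
    · refine ⟨0,0,1,0,0, fun v => ?_⟩
      simp only [prod_ms, h]; simp; ring
    · refine ⟨0,0,0,1,0, fun v => ?_⟩
      simp only [prod_ms, h]; simp; ring
    · refine ⟨0,0,0,0,1, fun v => ?_⟩
      simp only [prod_ms, h]; simp; ring
  | zero => exact ⟨0,0,0,0,0, by simp⟩
  | add x y _ _ hx hy =>
    obtain ⟨A,B,C,D,E,h⟩ := hx
    obtain ⟨A',B',C',D',E',h'⟩ := hy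
    exact ⟨A+A',B+B',C+C',D+D',E+E', fun v => by simp only [Pi.add_apply, h, h']; ring⟩
  | smul a x _ hx =>
    obtain ⟨A,B,C,D,E,h⟩ := hx
    exact ⟨a*A,a*B,a*C,a*D,a*E, fun v => by simp only [Pi.smul_apply, smul_eq_mul, h]; ring⟩

theorem form2 {V : Type} (L : V → (Fin 4 → ℂ)) (f : V → ℂ)
    (hf : f ∈ Submodule.span ℂ {h : V → ℂ | ∃ m : Fin 2 → Fin 4, 7 ∣ ∑ i, wt (m i) ∧ h = fun v => ∏ i, L v (m i)}) :
    ∃ A : ℂ, ∀ v, f v = A * (L v 0)^2 := by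
  induction hf using Submodule.span_induction with
  | mem x h =>
    obtain ⟨m, hm, rfl⟩ := h
    refine ⟨1, fun v => ?_⟩
    simp only [prod_ms, mons2 m hm]; simp; ring
  | zero => exact ⟨0, by simp⟩
  | add x y _ _ hx hy =>
    obtain ⟨A,h⟩ := hx
    obtain ⟨A',h'⟩ := hy
    exact ⟨A+A', fun v => by simp only [Pi.add_apply, h, h']; ring⟩
  | smul a x _ hx =>
    obtain ⟨A,h⟩ := hx
    exact ⟨a*A, fun v => by simp only [Pi.smul_apply, smul_eq_mul, h]; ring⟩
theorem exists_eig {V : Type} [AddCommGroup V] [Module ℂ V] [FiniteDimensional ℂ V]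
    (t : Module.End ℂ V) (h7 : t^7 = 1) (h1 : t ≠ 1) :
    ∃ (z : ℂ) (e : V), z^6+z^5+z^4+z^3+z^2+z+1=0 ∧ e ≠ 0 ∧ t e = z • e := by
  let W := LinearMap.range (t - 1)
  have hW : ∀ x ∈ W, t x ∈ W := by
    rintro x ⟨y, rfl⟩
    exact ⟨t y, by simp⟩
  have hne : Nontrivial W := by
    rw [Submodule.nontrivial_iff_ne_bot]
    intro h
    exact h1 (sub_eq_zero.1 (LinearMap.range_eq_bot.1 h))
  obtain ⟨z, hz⟩ := Module.End.exists_eigenvalue (t.restrict hW)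
  obtain ⟨⟨w, y, hy⟩, hw⟩ := hz.exists_hasEigenvector
  have hw1 : t w = z • w := congrArg Subtype.val hw.apply_eq_smul
  have hw0 : w ≠ 0 := fun h => hw.2 (Subtype.ext h)
  have hpow : ∀ n : ℕ, (t^n) w = z^n • w := by
    intro n
    induction n with
    | zero => simp
    | succ n ih => rw [pow_succ', Module.End.mul_apply, ih, map_smul, hw1, smul_smul, pow_succ]
  have e : (t^6+t^5+t^4+t^3+t^2+t+1) * (t-1) = 0 := by
    have : (t^6+t^5+t^4+t^3+t^2+t+1) * (t-1) = t^7 - 1 := by noncomm_ring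
    rw [this, h7, sub_self]
  have e2 := LinearMap.congr_fun e y
  rw [Module.End.mul_apply, hy] at e2
  simp only [LinearMap.add_apply, hpow, hw1, Module.End.one_apply, LinearMap.zero_apply] at e2
  have e3 : (z^6+z^5+z^4+z^3+z^2+z+1) • w = 0 := by
    rw [← e2]; module
  exact ⟨z, w, (smul_eq_zero.1 e3).resolve_right hw0, hw0, hw1⟩

theorem inj3 (z : ℂ) (hz : z^6+z^5+z^4+z^3+z^2+z+1=0) :
    Function.Injective ![(1:ℂ), z, z^2, z^4] := by
  have ho := z_order z hz
  have : ∀ i j : ℕ, i < 7 → j < 7 → z^i = z^j → i = j := by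
    intro i j hi hj h
    have hz0 : IsOfFinOrder z := by rw [← orderOf_pos_iff, ho]; norm_num
    exact pow_injOn_Iio_orderOf (by simpa [ho] using hi) (by simpa [ho] using hj) h
  have e : ![(1:ℂ), z, z^2, z^4] = fun i => z ^ wt i := by
    funext i; fin_cases i <;> simp [wt]
  rw [e]
  intro i j h
  have := this _ _ (by fin_cases i <;> simp [wt]) (by fin_cases j <;> simp [wt]) h
  clear h; revert this; revert i j; simp only [wt]; decide

theorem exists_fix {V : Type} [AddCommGroup V] [Module ℂ V] [FiniteDimensional ℂ V]
    (hdim : Module.finrank ℂ V = 4) (t : Module.End ℂ V) (hdet : LinearMap.det t = 1)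
    (z : ℂ) (hz : z^6+z^5+z^4+z^3+z^2+z+1=0) (e1 e2 e3 : V) (h1 : e1 ≠ 0) (h2 : e2 ≠ 0) (h3 : e3 ≠ 0)
    (t1 : t e1 = z • e1) (t2 : t e2 = z^2 • e2) (t3 : t e3 = z^4 • e3) :
    ∃ e0 : V, e0 ≠ 0 ∧ t e0 = e0 := by
  have z7 : z^7 = 1 := by linear_combination (z-1)*hz
  have hinj := inj3 z hz
  have ht : LinearIndependent ℂ ![e1,e2,e3] := by
    apply Module.End.eigenvectors_linearIndependent' t ![z,z^2,z^4]
    · intro i j h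
      have := @hinj i.succ j.succ (by simpa using h)
      exact Fin.succ_injective _ this
    · intro i
      rw [Module.End.hasEigenvector_iff, Module.End.mem_eigenspace_iff]
      fin_cases i <;> simp [*]
  obtain ⟨u, hu⟩ : ∃ u, u ∉ Submodule.span ℂ (Set.range ![e1,e2,e3]) := by
    by_contra! h
    have h2 : Submodule.span ℂ (Set.range ![e1,e2,e3]) = ⊤ := by
      rw [eq_top_iff]; exact fun x _ => h x
    have h3 := finrank_range_le_card (R := ℂ) ![e1,e2,e3]
    unfold Set.finrank at h3
    rw [h2, finrank_top, hdim] at h3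
    simp at h3
  have hli : LinearIndependent ℂ ![u,e1,e2,e3] := linearIndependent_finCons.2 ⟨ht, hu⟩
  let b := basisOfLinearIndependentOfCardEqFinrank hli (by simp [hdim])
  have hb : ⇑b = ![u,e1,e2,e3] := by simp [b]
  have b0 : b 0 = u := by simp [hb]
  have b1 : b 1 = e1 := by simp [hb]
  have b2 : b 2 = e2 := by simp [hb]
  have b3 : b 3 = e3 := by simp [hb]
  have tb1 : t (b 1) = z • b 1 := by rw [b1, t1]
  have tb2 : t (b 2) = z^2 • b 2 := by rw [b2, t2]
  have tb3 : t (b 3) = z^4 • b 3 := by rw [b3, t3]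
  have hm : LinearMap.toMatrix b b t = !![b.repr (t u) 0, 0,0,0; b.repr (t u) 1, z, 0, 0;
      b.repr (t u) 2, 0, z^2, 0; b.repr (t u) 3, 0, 0, z^4] := by
    ext i j
    rw [LinearMap.toMatrix_apply]
    fin_cases j
    · fin_cases i <;> simp [b0]
    · fin_cases i <;> simp [tb1]
    · fin_cases i <;> simp [tb2]
    · fin_cases i <;> simp [tb3]
  rw [← LinearMap.det_toMatrix b, hm] at hdet
  simp [Matrix.det_succ_row_zero, Fin.sum_univ_succ] at hdet
  have hc : b.repr (t u) 0 = 1 := by linear_combination hdet - b.repr (t u) 0 * z7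
  have hsum := b.sum_repr (t u)
  rw [Fin.sum_univ_four, hc, b0, b1, b2, b3] at hsum
  have n1 : z - 1 ≠ 0 := fun h => absurd (@hinj 1 0 (by simpa using sub_eq_zero.1 h)) (by decide)
  have n2 : z^2 - 1 ≠ 0 := fun h => absurd (@hinj 2 0 (by simpa using sub_eq_zero.1 h)) (by decide)
  have n3 : z^4 - 1 ≠ 0 := fun h => absurd (@hinj 3 0 (by simpa using sub_eq_zero.1 h)) (by decide)
  generalize b.repr (t u) 1 = α at hsum
  generalize b.repr (t u) 2 = β at hsum
  generalize b.repr (t u) 3 = γ at hsum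
  refine ⟨u - (α/(z-1)) • e1 - (β/(z^2-1)) • e2 - (γ/(z^4-1)) • e3, ?_, ?_⟩
  · intro h
    apply hu
    have : u = (α/(z-1)) • e1 + (β/(z^2-1)) • e2 + (γ/(z^4-1)) • e3 := by
      rw [← sub_eq_zero, ← h]; module
    rw [this]
    refine add_mem (add_mem ?_ ?_) ?_ <;> apply Submodule.smul_mem <;> apply Submodule.subset_span
    exacts [⟨0, rfl⟩, ⟨1, rfl⟩, ⟨2, rfl⟩]
  · have q1 : z - 1 = z - 1 := rfl
    simp only [map_sub, map_smul, t1, t2, t3, ← hsum]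
    match_scalars <;> field_simp <;> ring
theorem matS (z : ℂ) (hz : z^6+z^5+z^4+z^3+z^2+z+1=0) (M T D : Matrix (Fin 4) (Fin 4) ℂ)
    (hT : T = !![1,0,0,0;0,z,0,0;0,0,z^2,0;0,0,0,z^4])
    (hD : D = !![1,0,0,0;0,0,0,1;0,1,0,0;0,0,1,0])
    (hSS : M * M = -1) (hSD : M * D = D * D * M) (hST : T * M * T * M * T = M) :
    ∃ a b c : ℂ, a^2 = -1/7 ∧ b*c = 2*a^2 ∧
      M = !![a, b, b, b; c, a*((z+z^6)^2-2), a*(z+z^6), a*(1-(z+z^6)-(z+z^6)^2);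
        c, a*(z+z^6), a*(1-(z+z^6)-(z+z^6)^2), a*((z+z^6)^2-2);
        c, a*(1-(z+z^6)-(z+z^6)^2), a*((z+z^6)^2-2), a*(z+z^6)] := by
  have d := fun i j => congrFun (congrFun hSD i) j
  have s := fun i j => congrFun (congrFun hSS i) j
  have t := fun i j => congrFun (congrFun hST i) j
  have e1 := d 0 1
  have e2 := d 0 2
  have e3 := d 1 0
  have e4 := d 2 0
  have f1 := d 1 1
  have f2 := d 1 2
  have f3 := d 1 3
  have f4 := d 2 1
  have f5 := d 2 2
  have f6 := d 2 3
  have s0 := s 0 0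
  have s1 := s 0 1
  have t0 := t 0 0
  have t1 := t 0 1
  have t2 := t 0 2
  have t3 := t 0 3
  clear d s t
  subst hT hD
  simp [Matrix.mul_apply, Fin.sum_univ_four] at e1 e2 e3 e4 f1 f2 f3 f4 f5 f6 s0 s1 t0 t1 t2 t3
  have hM : M = !![M 0 0, M 0 1, M 0 2, M 0 3; M 1 0, M 1 1, M 1 2, M 1 3;
    M 2 0, M 2 1, M 2 2, M 2 3; M 3 0, M 3 1, M 3 2, M 3 3] := by
    ext i j; fin_cases i <;> fin_cases j <;> rfl
  generalize M 0 0 = a at *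
  generalize M 0 1 = b at *
  generalize M 0 2 = b2 at *
  generalize M 0 3 = b3 at *
  generalize M 1 0 = c at *
  generalize M 2 0 = c2 at *
  generalize M 3 0 = c3 at *
  generalize M 1 1 = m11 at *
  generalize M 1 2 = m12 at *
  generalize M 1 3 = m13 at *
  generalize M 2 1 = m21 at *
  generalize M 2 2 = m22 at *
  generalize M 2 3 = m23 at *
  generalize M 3 1 = m31 at *
  generalize M 3 2 = m32 at *
  generalize M 3 3 = m33 at *
  subst_vars
  simp only [Matrix.vecMul, dotProduct, Matrix.mul_apply, Fin.sum_univ_four, Matrix.of_apply, Matrix.cons_val] at t0 t1 t2 t3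
  obtain ⟨k1, k2, k3, k4, k5⟩ := solveS z a b3 c3 m32 m33 m31 hz (by linear_combination s0)
    (by linear_combination t0) (by linear_combination s1) (by linear_combination t1)
    (by linear_combination t2) (by linear_combination t3)
  exact ⟨a, b3, c3, k1, k2, by rw [k3, k4, k5]⟩
theorem normal_form (V : Type) [AddCommGroup V] [Module ℂ V] [FiniteDimensional ℂ V]
    (ρ : Representation ℂ SL2F7 V)
    (hfaithful : Function.Injective ρ)
    (hdim : Module.finrank ℂ V = 4)
    (hneg : ρ (-1) = -1) :
    ∃ (L : V ≃ₗ[ℂ] (Fin 4 → ℂ)) (z a : ℂ), z^6+z^5+z^4+z^3+z^2+z+1=0 ∧ a^2 = -1/7 ∧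
      (∀ v i, L (ρ gT v) i = z^(wt i) * L v i) ∧
      (∀ v, L (ρ gD v) = ![L v 0, L v 3, L v 1, L v 2]) ∧
      (∀ v, L (ρ gS v) = ![a*(L v 0 + 2*L v 1+2*L v 2+2*L v 3),
        a*(L v 0 + ((z+z^6)^2-2)*L v 1 + (z+z^6)*L v 2 + (1-(z+z^6)-(z+z^6)^2)*L v 3),
        a*(L v 0 + (z+z^6)*L v 1 + (1-(z+z^6)-(z+z^6)^2)*L v 2 + ((z+z^6)^2-2)*L v 3),
        a*(L v 0 + (1-(z+z^6)-(z+z^6)^2)*L v 1 + ((z+z^6)^2-2)*L v 2 + (z+z^6)*L v 3)]) := by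
  have hT7 : (ρ gT)^7 = 1 := by rw [← map_pow, rel_T7, map_one]
  have hT1 : ρ gT ≠ 1 := fun h => rel_T1 (hfaithful (h.trans (map_one ρ).symm))
  obtain ⟨z, e1, hz, h1, t1⟩ := exists_eig (ρ gT) hT7 hT1
  have hTD : ∀ v, ρ gT (ρ gD v) = ρ gD (ρ gT (ρ gT v)) := by
    intro v
    rw [← Module.End.mul_apply, ← map_mul, rel_TD, pow_two, map_mul, map_mul]; rfl
  have hD3 : ∀ v, ρ gD (ρ gD (ρ gD v)) = v := by
    intro v
    have : ρ (gD^3) v = v := by rw [rel_D3, map_one]; rfl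
    rw [pow_succ, pow_two, map_mul, map_mul] at this; exact this
  have hDinj : ∀ v, v ≠ 0 → ρ gD v ≠ 0 := fun v hv h => hv (by rw [← hD3 v, h]; simp)
  have hdet : LinearMap.det (ρ gT) = 1 := by
    have ha := congrArg (fun g => LinearMap.det (ρ g)) rel_TD
    have hb := congrArg (fun g => LinearMap.det (ρ g)) rel_T7
    have hc := congrArg (fun g => LinearMap.det (ρ g)) rel_D3
    simp only [map_mul, map_pow, map_one] at ha hb hc
    have hd : LinearMap.det (ρ gD) ≠ 0 := by
      intro h; rw [h] at hc; norm_num at hc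
    have ht : LinearMap.det (ρ gT) ≠ 0 := by
      intro h; rw [h] at hb; norm_num at hb
    apply mul_left_cancel₀ hd
    apply mul_left_cancel₀ ht
    linear_combination -ha
  obtain ⟨e2, he2⟩ : ∃ e2, e2 = ρ gD e1 := ⟨_, rfl⟩
  obtain ⟨e3, he3⟩ : ∃ e3, e3 = ρ gD e2 := ⟨_, rfl⟩
  have he1 : ρ gD e3 = e1 := by rw [he3, he2, hD3]
  have h2 : e2 ≠ 0 := he2 ▸ hDinj _ h1
  have h3 : e3 ≠ 0 := he3 ▸ hDinj _ h2
  have t2 : ρ gT e2 = z^2 • e2 := by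
    rw [he2, hTD, t1, map_smul, t1, map_smul, map_smul, smul_smul, pow_two]
  have t3 : ρ gT e3 = z^4 • e3 := by
    rw [he3, hTD, t2, map_smul, t2, map_smul, map_smul, smul_smul]; congr 1; ring
  obtain ⟨e0, h0, t0⟩ := exists_fix hdim (ρ gT) hdet z hz e1 e2 e3 h1 h2 h3 t1 t2 t3
  have hinj := inj3 z hz
  have hli : LinearIndependent ℂ ![e0,e1,e2,e3] := by
    apply Module.End.eigenvectors_linearIndependent' (ρ gT) _ hinj
    intro i
    rw [Module.End.hasEigenvector_iff, Module.End.mem_eigenspace_iff]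
    fin_cases i
    exacts [⟨by simpa using t0, h0⟩, ⟨t1, h1⟩, ⟨t2, h2⟩, ⟨t3, h3⟩]
  let B := basisOfLinearIndependentOfCardEqFinrank hli (by simp [hdim])
  have hB : ⇑B = ![e0,e1,e2,e3] := by simp [B]
  clear_value B
  have b0 : B 0 = e0 := by simp [hB]
  have b1 : B 1 = e1 := by simp [hB]
  have b2 : B 2 = e2 := by simp [hB]
  have b3 : B 3 = e3 := by simp [hB]
  rw [← b0] at t0
  rw [← b1] at t1
  rw [← b2] at t2
  rw [← b3] at t3
  rw [← b1, ← b2] at he2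
  rw [← b2, ← b3] at he3
  rw [← b1, ← b3] at he1
  let R : SL2F7 → Matrix (Fin 4) (Fin 4) ℂ := fun g => LinearMap.toMatrix B B (ρ g)
  have Rmul : ∀ g h, R (g*h) = R g * R h := by
    intro g h; simp only [R]; rw [map_mul, LinearMap.toMatrix_mul]
  have hRT : R gT = !![1,0,0,0;0,z,0,0;0,0,z^2,0;0,0,0,z^4] := by
    ext i j
    simp only [R]
    rw [LinearMap.toMatrix_apply]
    fin_cases j
    · fin_cases i <;> simp [t0]
    · fin_cases i <;> simp [t1]
    · fin_cases i <;> simp [t2]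
    · fin_cases i <;> simp [t3]
  have hact : ∀ g v, (B.repr (ρ g v) : Fin 4 → ℂ) = (R g).mulVec (B.repr v) := by
    intro g v; exact (LinearMap.toMatrix_mulVec_repr B B (ρ g) v).symm
  have hD0 : ρ gD (B 0) = B.repr (ρ gD (B 0)) 0 • B 0 := by
    have hx : ρ gT (ρ gD (B 0)) = ρ gD (B 0) := by rw [hTD, t0, t0]
    have hy := hact gT (ρ gD (B 0))
    rw [hx, hRT] at hy
    have n1 : z ≠ 1 := fun h => absurd (@hinj 1 0 (by simpa using h)) (by decide)
    have n2 : z^2 ≠ 1 := fun h => absurd (@hinj 2 0 (by simpa using h)) (by decide)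
    have n3 : z^4 ≠ 1 := fun h => absurd (@hinj 3 0 (by simpa using h)) (by decide)
    have y1 := congrFun hy 1
    have y2 := congrFun hy 2
    have y3 := congrFun hy 3
    simp only [Matrix.mulVec, dotProduct, Fin.sum_univ_four, Matrix.of_apply, Matrix.cons_val] at y1 y2 y3
    have := B.sum_repr (ρ gD (B 0))
    rw [Fin.sum_univ_four] at this
    have w1 : B.repr (ρ gD (B 0)) 1 = 0 := by
      apply (mul_eq_zero.1 _).resolve_left (sub_ne_zero.2 n1); linear_combination -y1
    have w2 : B.repr (ρ gD (B 0)) 2 = 0 := by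
      apply (mul_eq_zero.1 _).resolve_left (sub_ne_zero.2 n2); linear_combination -y2
    have w3 : B.repr (ρ gD (B 0)) 3 = 0 := by
      apply (mul_eq_zero.1 _).resolve_left (sub_ne_zero.2 n3); linear_combination -y3
    rw [w1, w2, w3] at this
    simpa using this.symm
  generalize B.repr (ρ gD (B 0)) 0 = ω at hD0
  have hRD : R gD = !![ω,0,0,0;0,0,0,1;0,1,0,0;0,0,1,0] := by
    ext i j
    simp only [R]
    rw [LinearMap.toMatrix_apply]
    fin_cases j
    · fin_cases i <;> simp [hD0]
    · fin_cases i <;> simp [← he2]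
    · fin_cases i <;> simp [← he3]
    · fin_cases i <;> simp [he1]
  have hω : ω = 1 := by
    have hw3 : ω^3 = 1 := by
      have := hD3 (B 0)
      rw [hD0, map_smul, hD0, map_smul, map_smul, hD0, smul_smul, smul_smul] at this
      have h := congrArg (fun v => B.repr v 0) this
      simp at h
      linear_combination h
    have htr : (R gD).trace = (R gD * R gD).trace := by
      rw [← Rmul, rel_DD, Rmul, Rmul, Matrix.trace_mul_cycle, ← Rmul, ← Rmul, rel_S4]
    rw [hRD] at htr
    simp [Matrix.trace, Fin.sum_univ_four] at htr
    linear_combination hw3 + (1 + ω) * htr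
  rw [hω] at hRD
  obtain ⟨a, b, c, ha, hbc, hM⟩ := matS z hz (R gS) (R gT) (R gD) hRT hRD
    (by rw [← Rmul, rel_SS]; simp only [R]; rw [hneg, map_neg, LinearMap.toMatrix_one])
    (by rw [← Rmul, ← Rmul, ← Rmul, rel_SD])
    (by rw [← Rmul, ← Rmul, ← Rmul, ← Rmul, rel_ST])
  have ha0 : a ≠ 0 := by rintro rfl; norm_num at ha
  have hc0 : c ≠ 0 := by
    rintro rfl
    rw [ha] at hbc; norm_num at hbc
  let w : Fin 4 → ℂ := ![a/c, 1, 1, 1]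
  have hw : ∀ i, IsUnit (w i) := by
    intro i; fin_cases i <;> simp [w, ha0, hc0]
  let L := (B.isUnitSMul hw).equivFun
  have hL : ∀ v, L v = ![c/a * B.repr v 0, B.repr v 1, B.repr v 2, B.repr v 3] := by
    intro v
    funext i
    simp only [L, Module.Basis.equivFun_apply, Module.Basis.repr_isUnitSMul]
    fin_cases i <;> simp [w, Units.smul_def]
  clear_value L
  have hb : b = 2*a^2/c := by field_simp; linear_combination hbc
  refine ⟨L, z, a, hz, ha, ?_, ?_, ?_⟩
  · intro v i
    rw [hL, hL, hact, hRT]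
    fin_cases i <;> simp [Matrix.mulVec, dotProduct, Fin.sum_univ_four, wt]
  · intro v
    rw [hL, hL, hact, hRD]
    funext i
    fin_cases i <;> simp [Matrix.mulVec, dotProduct, Fin.sum_univ_four]
  · intro v
    rw [hL, hL, hact, hM, hb]
    funext i
    fin_cases i <;> simp [Matrix.mulVec, dotProduct, Fin.sum_univ_four] <;> field_simp
/-- Let `V` be a faithful irreducible four-dimensional complex representation of the
quasi-simple group `SL₂(F₇)`.  Then there are no nonzero `SL₂(F₇)`-invariant homogeneous
polynomial functions on `V` of degree `1`, `2` or `3`, and the space of invariant homogeneous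
polynomial functions of degree `4` is one-dimensional. -/
theorem SL2F7_four_dim_invariants
    (V : Type) [AddCommGroup V] [Module ℂ V] [FiniteDimensional ℂ V]
    (ρ : Representation ℂ SL2F7 V)
    (hfaithful : Function.Injective ρ)
    (hdim : Module.finrank ℂ V = 4)
    (hirr : ∀ W : Submodule ℂ V, (∀ g : SL2F7, ∀ v ∈ W, ρ g v ∈ W) → W = ⊥ ∨ W = ⊤) :
    (∀ d : ℕ, 1 ≤ d → d ≤ 3 →
      ∀ f ∈ homPoly V d, (∀ g : SL2F7, (fun v => f (ρ g v)) = f) → f = 0) ∧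
    (∃ f₀ ∈ homPoly V 4, f₀ ≠ 0 ∧ (∀ g : SL2F7, (fun v => f₀ (ρ g v)) = f₀) ∧
      ∀ f ∈ homPoly V 4, (∀ g : SL2F7, (fun v => f (ρ g v)) = f) → ∃ c : ℂ, f = c • f₀) := by
  have hneg : ρ (-1) = -1 := by
    have hsq : ∀ v, ρ (-1) (ρ (-1) v) = v := by
      intro v
      rw [← Module.End.mul_apply, ← map_mul, neg_mul_neg, one_mul, map_one]; rfl
    have hcomm : ∀ g v, ρ (-1) (ρ g v) = ρ g (ρ (-1) v) := by
      intro g v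
      rw [← Module.End.mul_apply, ← Module.End.mul_apply, ← map_mul, ← map_mul]
      congr 2; simp
    rcases hirr (LinearMap.ker (ρ (-1) - 1)) (by
      intro g v hv
      rw [LinearMap.mem_ker, LinearMap.sub_apply, sub_eq_zero, Module.End.one_apply] at hv ⊢
      rw [hcomm, hv]) with h | h
    · ext v
      have : ρ (-1) v + v ∈ LinearMap.ker (ρ (-1) - 1) := by
        rw [LinearMap.mem_ker, LinearMap.sub_apply, sub_eq_zero, Module.End.one_apply, map_add, hsq,
          add_comm]
      rw [h, Submodule.mem_bot] at this
      simpa using eq_neg_of_add_eq_zero_left this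
    · exfalso
      apply rel_neg
      apply hfaithful
      rw [map_one]
      exact sub_eq_zero.1 (LinearMap.ker_eq_top.1 h)
  obtain ⟨L, z, a, hz, ha, hT, hD, hS⟩ := normal_form V ρ hfaithful hdim hneg
  have hz7 : z^7 = 1 := by linear_combination (z-1)*hz
  have hp : (z+z^6)^3+(z+z^6)^2-2*(z+z^6)-1=0 := by
    linear_combination (-1 + 3*z - 2*z^6 + z^11 + z^4 + 3*z^6 + z^5 + 2 + 1 + 2*z^6) * hz7 + hz
  generalize z + z^6 = p at hS hp
  have ha4 : a^4 = 1/49 := by linear_combination (a^2 - 1/7)*ha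
  have hodd : ∀ d, Odd d → ∀ f ∈ homPoly V d,
      (∀ g : SL2F7, (fun v => f (ρ g v)) = f) → f = 0 := by
    intro d hd f hf hinv
    funext v
    have h1 := homPoly_neg d f hf v
    have h2 := congrFun (hinv (-1)) v
    simp only [hneg, LinearMap.neg_apply, Module.End.one_apply] at h2
    rw [h2, hd.neg_one_pow] at h1
    simp only [Pi.zero_apply]
    linear_combination h1 / 2
  refine ⟨?_, ?_⟩
  · intro d h1 h3 f hf hinv
    interval_cases d
    · exact hodd 1 (by decide) f hf hinv
    · have := avg_mem L 2 z hz (fun v => ρ gT v) hT f hf (fun v => congrFun (hinv gT) v)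
      obtain ⟨A, hA⟩ := form2 L f this
      have e := congrFun (hinv gS) (L.symm ![0,1,0,0])
      simp only [hA, hS, LinearEquiv.apply_symm_apply, Matrix.cons_val] at e
      have hA0 : A = 0 := by linear_combination (-7/4) * e + 7 * A * ha
      funext v
      simp [hA, hA0]
    · exact hodd 3 (by decide) f hf hinv
  · have hq : ∀ g : SL2F7, ∀ v, (fun v => (L v 0)^4 + 24*(L v 0*L v 1*L v 2*L v 3) +
        8*((L v 1)^3*L v 3+(L v 2)^3*L v 1+(L v 3)^3*L v 2)) (ρ g v) = (L v 0)^4 +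
        24*(L v 0*L v 1*L v 2*L v 3) + 8*((L v 1)^3*L v 3+(L v 2)^3*L v 1+(L v 3)^3*L v 2) := by
      intro g
      refine gen_ind (fun g => ∀ v, (fun v => (L v 0)^4 + 24*(L v 0*L v 1*L v 2*L v 3) +
        8*((L v 1)^3*L v 3+(L v 2)^3*L v 1+(L v 3)^3*L v 2)) (ρ g v) = (L v 0)^4 +
        24*(L v 0*L v 1*L v 2*L v 3) + 8*((L v 1)^3*L v 3+(L v 2)^3*L v 1+(L v 3)^3*L v 2))
        ?_ ?_ ?_ ?_ g
      · intro g h hg hh v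
        rw [map_mul, Module.End.mul_apply]
        exact (hg _).trans (hh v)
      · intro v; simp
      · intro v
        simp only [hT]
        simp only [wt, Matrix.cons_val]
        generalize L v 0 = x0
        generalize L v 1 = x1
        generalize L v 2 = x2
        generalize L v 3 = x3
        linear_combination (24*(x0*x1*x2*x3) + 8*(x1^3*x3+x2^3*x1+x3^3*x2*(z^7+1)))*hz7
      · intro v
        have := quartic_S p (L v 0) (L v 1) (L v 2) (L v 3) _ _ _ _ hp rfl rfl rfl rfl
        simp only [hS, Matrix.cons_val]
        linear_combination a^4 * this + 49 * ((L v 0)^4 +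
          24*(L v 0*L v 1*L v 2*L v 3) + 8*((L v 1)^3*L v 3+(L v 2)^3*L v 1+(L v 3)^3*L v 2)) * ha4
    refine ⟨fun v => (L v 0)^4 + 24*(L v 0*L v 1*L v 2*L v 3) +
        8*((L v 1)^3*L v 3+(L v 2)^3*L v 1+(L v 3)^3*L v 2), ?_, ?_, ?_, ?_⟩
    · have hm : ∀ m : Fin 4 → Fin 4, (fun v => ∏ i, L v (m i)) ∈ homPoly V 4 := fun m =>
        Submodule.subset_span ⟨fun i => (LinearMap.proj (m i)).comp L.toLinearMap, rfl⟩
      have h := add_mem (add_mem (hm ![0,0,0,0]) (Submodule.smul_mem _ 24 (hm ![0,1,2,3])))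
        (Submodule.smul_mem _ 8 (add_mem (add_mem (hm ![1,1,1,3]) (hm ![2,2,2,1])) (hm ![3,3,3,2])))
      convert h using 1
      funext v
      simp [Fin.prod_univ_four]
      ring
    · intro h
      have := congrFun h (L.symm ![1,0,0,0])
      simp at this
    · intro g; funext v; exact hq g v
    · intro f hf hinv
      have := avg_mem L 4 z hz (fun v => ρ gT v) hT f hf (fun v => congrFun (hinv gT) v)
      obtain ⟨A, B, C1, C2, C3, hA⟩ := form4 L f this
      have d1 := congrFun (hinv gD) (L.symm ![0,1,0,1])
      have d2 := congrFun (hinv gD) (L.symm ![0,1,1,0])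
      have s1 := congrFun (hinv gS) (L.symm ![1,0,0,0])
      have s2 := congrFun (hinv gS) (L.symm ![0,1,0,0])
      simp only [hA, hS, hD, LinearEquiv.apply_symm_apply, Matrix.cons_val] at d1 d2 s1 s2
      have c1 : C2 = C1 := by linear_combination d1
      have c2 : C3 = C2 := by linear_combination d2
      subst c2 c1
      refine ⟨A, ?_⟩
      have s1' : 48*A = B + 3*C3 := by
        linear_combination (-49)*s1 + 49 * (A + B + 3*C3) * ha4
      have s2' : 8*A + B - 4*C3 = 0 := by
        have g1 : (p^2-2)*p*(1-p-p^2) = 1 := by linear_combination (1-p^2)*hp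
        have g2 : (p^2-2)^3*(1-p-p^2)+p^3*(p^2-2)+(1-p-p^2)^3*p = -8 := by
          linear_combination (-9*p+p^2+3*p^3-p^4-p^5)*hp
        linear_combination (49/2)*s2 - (49/2) * (16*A + 2*B*((p^2-2)*p*(1-p-p^2)) + C3*((p^2-2)^3*(1-p-p^2)+p^3*(p^2-2)+(1-p-p^2)^3*p)) * ha4 - B*g1 - (C3/2)*g2
      have hC : C3 = 8*A := by linear_combination (1/7)*(-s1' - s2')
      have hB : B = 24*A := by linear_combination s2' + 4*hC
      funext v
      simp only [hA, hC, hB, Pi.smul_apply, smul_eq_mul]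
      ring
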